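/- arXiv:2501.13626 — 2 statements merged into one kernel-verified Lean document; each statement's English description precedes it below -/
import Mathlib

section
/- Let (a_n) be an arithmetic sequence and let x ∈ T be such that supp(x) is infinite but not co-finite in ℕ. If d̄(L(supp(x) \ (supp(x) - 1))) > 0, then x ∉ t^s_{(d_n)}(T). -/
open Filter Topology Set

noncomputable section

/-- The sequence of ratios `b n = a n / a (n-1)` of an arithmetic sequence. -/
def ratios (a : ℕ → ℕ) (n : ℕ) : ℕ := a n / a (n - 1)

/-- An arithmetic sequence: `a 0 = 1`, strictly increasing, each term divides the next. -/
def IsArithSeq (a : ℕ → ℕ) : Prop :=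
  a 0 = 1 ∧ (∀ n, a n < a (n + 1)) ∧ (∀ n, a n ∣ a (n + 1))

/-- The indices `n_k` with `a k = d (n k)`: `n 0 = 1`, `n (k+1) = n k + (b (k+1) - 1)`. -/
def nseq (a : ℕ → ℕ) : ℕ → ℕ
  | 0 => 1
  | k + 1 => nseq a k + (ratios a (k + 1) - 1)

/-- The lifting function `L(A) = ⋃_{k ∈ A} [n_{k-1}, n_k - 1]`. -/
def liftSet (a : ℕ → ℕ) (A : Set ℕ) : Set ℕ :=
  ⋃ k ∈ A, Set.Icc (nseq a (k - 1)) (nseq a k - 1)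

/-- `A ⊆ ℕ` has natural density `δ`. -/
def HasDensity (A : Set ℕ) (δ : ℝ) : Prop :=
  Tendsto (fun n : ℕ => ((A ∩ Set.Iio n).ncard : ℝ) / n) atTop (𝓝 δ)

/-- The upper natural density of `A ⊆ ℕ`. -/
def upperDensity (A : Set ℕ) : ℝ :=
  limsup (fun n : ℕ => ((A ∩ Set.Iio n).ncard : ℝ) / n) atTop

/-- The sequence `(d n)`: the increasing enumeration of `{r * a k : k ≥ 0, 1 ≤ r < b (k+1)}`. -/
def dSeq (a : ℕ → ℕ) : ℕ → ℕ :=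
  Nat.nth (fun m => ∃ k r : ℕ, 1 ≤ r ∧ r < ratios a (k + 1) ∧ m = r * a k)

/-- The characterized subgroup `t_{(u n)}(𝕋)`. -/
def charSub (u : ℕ → ℤ) : Set (AddCircle (1 : ℝ)) :=
  {x | Tendsto (fun n => u n • x) atTop (𝓝 0)}

/-- The statistically characterized subgroup `t^s_{(u n)}(𝕋)`. -/
def statChar (u : ℕ → ℤ) : Set (AddCircle (1 : ℝ)) :=
  {x | ∀ ε : ℝ, 0 < ε → HasDensity {n : ℕ | ε ≤ ‖u n • x‖} 0}

/-- Density lifting invariant. -/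
def Dli (a : ℕ → ℕ) : Prop :=
  ∀ A : Set ℕ, A.Infinite → HasDensity A 0 → HasDensity (liftSet a A) 0

/-- Weakly density lifting invariant. -/
def WeaklyDli (a : ℕ → ℕ) : Prop :=
  ∃ A : Set ℕ, A.Infinite ∧ ∀ m : ℕ, HasDensity (liftSet a ((fun x => x - m) '' A)) 0

/-- Strongly non density lifting invariant. -/
def StronglyNonDli (a : ℕ → ℕ) : Prop :=
  ∀ A : Set ℕ, A.Infinite → 0 < upperDensity (liftSet a A)

open Classical in
theorem ncard_inter_Iio_eq_count (A : Set ℕ) (n : ℕ) :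
    (A ∩ Set.Iio n).ncard = Nat.count (· ∈ A) n := by
  rw [Nat.count_eq_card_filter_range, ← Set.ncard_coe_finset]
  congr 1
  ext m
  simp [and_comm]

/-! ### Arithmetic sequences and the enumeration `dSeq` -/

namespace IsArithSeq

variable {a : ℕ → ℕ}

theorem strictMono (ha : IsArithSeq a) : StrictMono a := strictMono_nat_of_lt_succ ha.2.1

theorem pos (ha : IsArithSeq a) (n : ℕ) : 0 < a n := by
  have h := ha.strictMono.monotone (Nat.zero_le n)
  have := ha.1
  omega

theorem ratios_mul (ha : IsArithSeq a) (n : ℕ) : ratios a (n + 1) * a n = a (n + 1) :=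
  Nat.div_mul_cancel (ha.2.2 n)

theorem two_le_ratios (ha : IsArithSeq a) (n : ℕ) : 2 ≤ ratios a (n + 1) := by
  have h := ha.ratios_mul n
  have h' := ha.2.1 n
  by_contra! hlt
  have : ratios a (n + 1) * a n ≤ 1 * a n := Nat.mul_le_mul_right _ (by omega)
  omega

theorem dvd (ha : IsArithSeq a) {m n : ℕ} (h : m ≤ n) : a m ∣ a n := by
  induction n, h using Nat.le_induction with
  | base => exact dvd_rfl
  | succ n _ ih => exact ih.trans (ha.2.2 n)

theorem nseq_strictMono (ha : IsArithSeq a) : StrictMono (nseq a) :=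
  strictMono_nat_of_lt_succ fun n => by
    have := ha.two_le_ratios n
    simp only [nseq]
    omega

theorem one_le_nseq (ha : IsArithSeq a) (n : ℕ) : 1 ≤ nseq a n :=
  ha.nseq_strictMono.monotone (Nat.zero_le n)

/-- Between `a k` and `a (k+1)`, the values of `dSeq a` are multiples of `a k`. -/
theorem dvd_of_mem_range (ha : IsArithSeq a) {k m : ℕ} (h1 : a k ≤ m) (h2 : m < a (k + 1))
    (hm : ∃ j r : ℕ, 1 ≤ r ∧ r < ratios a (j + 1) ∧ m = r * a j) : a k ∣ m := by
  obtain ⟨j, r, hr1, hr2, rfl⟩ := hm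
  have hj := ha.ratios_mul j
  rcases lt_or_ge j k with h | h
  · have : r * a j < ratios a (j + 1) * a j := Nat.mul_lt_mul_of_pos_right hr2 (ha.pos j)
    have := ha.strictMono.monotone (show j + 1 ≤ k from h)
    omega
  · exact (ha.dvd h).mul_left r

end IsArithSeq

theorem Nat.count_eq_count_add_one_of_forall_not {p : ℕ → Prop} [DecidablePred p] {m m' : ℕ}
    (hm : p m) (hlt : m < m') (h : ∀ i, m < i → i < m' → ¬ p i) :
    Nat.count p m' = Nat.count p m + 1 := by
  rw [← Nat.count_succ_eq_succ_count hm]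
  induction m', hlt using Nat.le_induction with
  | base => rfl
  | succ n hn ih =>
    rw [Nat.count_succ, ih fun i h1 h2 => h i h1 (by omega), if_neg (h n hn (by omega)), add_zero]

open Classical in
theorem IsArithSeq.count_mul {a : ℕ → ℕ} (ha : IsArithSeq a) (k i : ℕ)
    (hi : i < ratios a (k + 1))
    (hk : Nat.count (fun m => ∃ k r : ℕ, 1 ≤ r ∧ r < ratios a (k + 1) ∧ m = r * a k) (a k)
      = nseq a k - 1) :
    Nat.count (fun m => ∃ k r : ℕ, 1 ≤ r ∧ r < ratios a (k + 1) ∧ m = r * a k) ((i + 1) * a k)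
      = nseq a k - 1 + i := by
  induction i with
  | zero => simpa using hk
  | succ i ih =>
    have hpos := ha.pos k
    rw [Nat.count_eq_count_add_one_of_forall_not (m := (i + 1) * a k)
      ⟨k, i + 1, by omega, hi, rfl⟩ (Nat.mul_lt_mul_of_pos_right (by omega) hpos), ih (by omega),
      add_assoc]
    intro n h1 h2 hn
    have hle : (i + 1 + 1) * a k ≤ ratios a (k + 1) * a k := Nat.mul_le_mul_right _ (by omega)
    rw [ha.ratios_mul] at hle
    have hge : 1 * a k ≤ (i + 1) * a k := Nat.mul_le_mul_right _ (by omega)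
    obtain ⟨q, rfl⟩ := ha.dvd_of_mem_range (k := k) (by omega) (by omega) hn
    rw [mul_comm (a k) q] at h1 h2
    have := lt_of_mul_lt_mul_right h1 hpos.le
    have := lt_of_mul_lt_mul_right h2 hpos.le
    omega

open Classical in
theorem IsArithSeq.count_self {a : ℕ → ℕ} (ha : IsArithSeq a) (k : ℕ) :
    Nat.count (fun m => ∃ k r : ℕ, 1 ≤ r ∧ r < ratios a (k + 1) ∧ m = r * a k) (a k)
      = nseq a k - 1 := by
  induction k with
  | zero =>
    rw [ha.1, Nat.count_succ, Nat.count_zero, if_neg]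
    · rfl
    · rintro ⟨k, r, h1, -, h2⟩
      have := Nat.mul_pos h1 (ha.pos k)
      omega
  | succ k ih =>
    have h2 := ha.two_le_ratios k
    have h1 := ha.one_le_nseq k
    have h := ha.count_mul k (ratios a (k + 1) - 1) (by omega) ih
    rw [Nat.sub_add_cancel (by omega), ha.ratios_mul] at h
    rw [h, nseq]
    omega

theorem IsArithSeq.dSeq_eq {a : ℕ → ℕ} (ha : IsArithSeq a) (k i : ℕ)
    (hi : i < ratios a (k + 1) - 1) : dSeq a (nseq a k - 1 + i) = (i + 1) * a k := by
  classical
  rw [← ha.count_mul k i (by omega) (ha.count_self k)]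
  exact Nat.nth_count ⟨k, i + 1, by omega, by omega, rfl⟩

/-! ### Multiples of a point of the circle that is not too close to `0` -/

/-- If `z` is at distance at least `1/(2(m+1))` from `0`, then at least a quarter of its first `m`
multiples stay away from `0`. -/
theorem le_four_mul_count_norm_nsmul {m : ℕ} (hm : 1 ≤ m) (s : ℝ)
    (h1 : 1 ≤ 2 * (m + 1) * s) (h2 : 1 ≤ 2 * (m + 1) * (1 - s)) :
    m ≤ 4 * Nat.count (fun i => (1 / 16 : ℝ) ≤ ‖(i + 1) • (s : AddCircle (1 : ℝ))‖) m := by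
  set z : AddCircle (1 : ℝ) := (s : AddCircle (1 : ℝ)) with hz
  have hm0 : (0 : ℝ) < m + 1 := by positivity
  obtain ⟨t, ht, htl, htu⟩ :
      ∃ t : ℝ, z = (t : AddCircle (1 : ℝ)) ∧ 1 ≤ 2 * (m + 1) * |t| ∧ |t| ≤ 1 / 2 := by
    rcases le_total s (1 / 2) with h | h
    · have : 0 < s := by by_contra!; nlinarith
      exact ⟨s, rfl, by rwa [abs_of_pos this], by rwa [abs_of_pos this]⟩
    · have : 0 < 1 - s := by by_contra!; nlinarith
      refine ⟨s - 1, ?_, ?_, ?_⟩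
      · rw [AddCircle.coe_sub, AddCircle.coe_period, sub_zero]
      · rwa [abs_sub_comm, abs_of_pos this]
      · rw [abs_sub_comm, abs_of_pos this]
        linarith
  have norm_nsmul_eq (h : ℕ) (hh : h * |t| ≤ 1 / 2) : ‖h • z‖ = h * |t| := by
    rw [ht, ← AddCircle.coe_nsmul, nsmul_eq_mul,
      (AddCircle.norm_coe_eq_abs_iff 1 one_ne_zero).2, abs_mul, Nat.abs_cast]
    simpa [abs_mul] using hh
  obtain ⟨h, hh1, hh, hhm⟩ : ∃ h : ℕ, 1 ≤ h ∧ 1 / 8 ≤ ‖h • z‖ ∧ (h = 1 ∨ 2 * h ≤ m) := by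
    rcases le_or_gt (1 / 8) |t| with h8 | h8
    · exact ⟨1, le_rfl, by rw [norm_nsmul_eq 1 (by simpa using htu)]; simpa using h8, Or.inl rfl⟩
    · have htpos : 0 < |t| := by by_contra!; nlinarith
      have hlow := Nat.le_ceil (1 / (8 * |t|))
      have hup := Nat.ceil_lt_add_one (show 0 ≤ 1 / (8 * |t|) by positivity)
      set h := ⌈1 / (8 * |t|)⌉₊
      have e : 1 / (8 * |t|) * |t| = 1 / 8 := by field_simp
      have hl : 1 / 8 ≤ h * |t| := by
        rw [← e]
        gcongr
      have hu : h * |t| < 1 / 4 := by nlinarith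
      refine ⟨h, ?_, by rwa [norm_nsmul_eq h (by linarith)], Or.inr ?_⟩
      · by_contra! h0
        have : h = 0 := by omega
        rw [this] at hl
        norm_num at hl
      · have : (2 * h : ℝ) < m + 1 := by
          by_contra! hc
          nlinarith [mul_le_mul_of_nonneg_right hc htpos.le]
        have : 2 * h < m + 1 := by exact_mod_cast this
        omega
  have hhm' : h ≤ m := by omega
  rw [Nat.count_eq_card_filter_range]
  set F := (Finset.range m).filter (fun i => (1 / 16 : ℝ) ≤ ‖(i + 1) • z‖) with hF
  have hmem : h - 1 ∈ F := by
    rw [hF, Finset.mem_filter, Finset.mem_range, Nat.sub_add_cancel hh1]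
    exact ⟨by omega, by linarith⟩
  have hFpos : 1 ≤ F.card := Finset.card_pos.2 ⟨_, hmem⟩
  have hsub : Finset.range (m - h) ⊆ F ∪ F.preimage (· + h) (by simp) := by
    intro i hi
    rw [Finset.mem_range] at hi
    rw [Finset.mem_union, Finset.mem_preimage, hF, Finset.mem_filter, Finset.mem_filter,
      Finset.mem_range, Finset.mem_range]
    by_contra! hc
    have c1 := hc.1 (by omega)
    have c2 := hc.2 (by omega)
    have hdiff : (i + h + 1) • z - (i + 1) • z = h • z := by
      rw [show i + h + 1 = h + (i + 1) by ring, add_nsmul z h (i + 1), add_sub_cancel_right]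
    have := norm_sub_le ((i + h + 1) • z) ((i + 1) • z)
    rw [hdiff] at this
    linarith
  have hcard := (Finset.card_le_card hsub).trans (Finset.card_union_le _ _)
  have hpre : (F.preimage (· + h) (by simp)).card ≤ F.card :=
    Finset.card_le_card_of_injOn (· + h) (fun i hi => by simpa using hi) (by simp)
  rw [Finset.card_range] at hcard
  omega

/-! ### Canonical representations -/

section Canonical

variable {a c : ℕ → ℕ}

theorem IsArithSeq.sum_range_div_le (ha : IsArithSeq a)
    (hcle : ∀ n, 1 ≤ n → c n ≤ ratios a n - 1) (k N : ℕ) :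
    ∑ i ∈ Finset.range N, (c (i + (k + 1)) : ℝ) / a (i + (k + 1)) ≤ 1 / a k := by
  have key : ∑ i ∈ Finset.range N, (c (i + (k + 1)) : ℝ) / a (i + (k + 1))
      ≤ 1 / a k - 1 / a (N + k) := by
    induction N with
    | zero => simp
    | succ N ih =>
      rw [Finset.sum_range_succ]
      have hc := hcle (N + k + 1) (by omega)
      have h2 := ha.two_le_ratios (N + k)
      have hr := ha.ratios_mul (N + k)
      have hc' : ((c (N + k + 1) : ℝ)) ≤ ratios a (N + k + 1) - 1 := by
        have : c (N + k + 1) + 1 ≤ ratios a (N + k + 1) := by omega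
        have : ((c (N + k + 1) : ℝ)) + 1 ≤ ratios a (N + k + 1) := by exact_mod_cast this
        linarith
      have hr' : (ratios a (N + k + 1) : ℝ) * a (N + k) = a (N + k + 1) := by exact_mod_cast hr
      have p0 : (0 : ℝ) < a (N + k) := by exact_mod_cast ha.pos _
      have p1 : (0 : ℝ) < a (N + k + 1) := by exact_mod_cast ha.pos _
      have hterm : (c (N + k + 1) : ℝ) / a (N + k + 1) ≤ 1 / a (N + k) - 1 / a (N + k + 1) := by
        rw [div_sub_div _ _ p0.ne' p1.ne', div_le_div_iff₀ p1 (by positivity)]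
        have : (c (N + k + 1) : ℝ) * a (N + k) ≤ a (N + k + 1) - a (N + k) := by nlinarith
        nlinarith
      rw [show N + (k + 1) = N + k + 1 by ring, show N + 1 + k = N + k + 1 by ring]
      linarith
  have : (0 : ℝ) ≤ 1 / a (N + k) := by positivity
  linarith

theorem IsArithSeq.summable_div (ha : IsArithSeq a)
    (hcle : ∀ n, 1 ≤ n → c n ≤ ratios a n - 1) : Summable fun n => (c n : ℝ) / a n :=
  (summable_nat_add_iff 1).1 <| summable_of_sum_range_le (fun _ => by positivity)
    (ha.sum_range_div_le hcle 0)

theorem IsArithSeq.tsum_div_le (ha : IsArithSeq a)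
    (hcle : ∀ n, 1 ≤ n → c n ≤ ratios a n - 1) (k : ℕ) :
    ∑' i, (c (i + (k + 1)) : ℝ) / a (i + (k + 1)) ≤ 1 / a k :=
  Real.tsum_le_of_sum_range_le (fun _ => by positivity) (ha.sum_range_div_le hcle k)

/-- Multiplying `x` by `a k` erases the first `k` digits. -/
theorem IsArithSeq.nsmul_coe_tsum (ha : IsArithSeq a)
    (hcle : ∀ n, 1 ≤ n → c n ≤ ratios a n - 1) (k : ℕ) :
    a k • ((∑' n, (c n : ℝ) / a n : ℝ) : AddCircle (1 : ℝ))
      = ((a k * ∑' i, (c (i + (k + 1)) : ℝ) / a (i + (k + 1)) : ℝ) : AddCircle (1 : ℝ)) := by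
  rw [← AddCircle.coe_nsmul, nsmul_eq_mul, ← (ha.summable_div hcle).sum_add_tsum_nat_add (k + 1),
    mul_add, AddCircle.coe_add]
  convert zero_add _ using 2
  rw [AddCircle.coe_eq_zero_iff]
  refine ⟨∑ i ∈ Finset.range (k + 1), (a k / a i * c i : ℕ), ?_⟩
  rw [zsmul_one, Finset.mul_sum, Int.cast_sum]
  refine Finset.sum_congr rfl fun i hi => ?_
  have hi' : i ≤ k := by simpa [Nat.lt_succ_iff] using hi
  have p : (a i : ℝ) ≠ 0 := by exact_mod_cast (ha.pos i).ne'
  obtain ⟨q, hq⟩ := ha.dvd hi'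
  rw [hq, Nat.mul_div_cancel_left _ (ha.pos i)]
  push_cast
  field_simp

/-- A quarter of the multiples `r * a k`, `1 ≤ r < b (k+1)`, move `x` away from `0` whenever
`k + 1` is in the support of `x` and `k + 2` is not. -/
theorem IsArithSeq.ratios_sub_one_le_count (ha : IsArithSeq a)
    (hcle : ∀ n, 1 ≤ n → c n ≤ ratios a n - 1) {k : ℕ} (h1 : c (k + 1) ≠ 0)
    (h2 : c (k + 2) = 0) :
    ratios a (k + 1) - 1 ≤ 4 * Nat.count (fun i => (1 / 16 : ℝ) ≤
      ‖(i + 1) • a k • ((∑' n, (c n : ℝ) / a n : ℝ) : AddCircle (1 : ℝ))‖)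
      (ratios a (k + 1) - 1) := by
  rw [ha.nsmul_coe_tsum hcle]
  have hb := ha.two_le_ratios k
  have hb' := ha.two_le_ratios (k + 1)
  have hr := ha.ratios_mul k
  have hr' := ha.ratios_mul (k + 1)
  have hc := hcle (k + 1) (by omega)
  have hsum := ((summable_nat_add_iff (k + 1)).2 (ha.summable_div hcle)).sum_add_tsum_nat_add 2
  have e0 (i : ℕ) : i + 2 + (k + 1) = i + (k + 2 + 1) := by ring
  simp only [Finset.sum_range_succ, Finset.sum_range_zero, zero_add, e0] at hsum
  rw [show 1 + (k + 1) = k + 2 by ring, h2, Nat.cast_zero, zero_div, add_zero] at hsum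
  have htail := ha.tsum_div_le hcle (k + 2)
  have htail0 : 0 ≤ ∑' i, (c (i + (k + 2 + 1)) : ℝ) / a (i + (k + 2 + 1)) :=
    tsum_nonneg fun _ => by positivity
  set τ := ∑' i, (c (i + (k + 2 + 1)) : ℝ) / a (i + (k + 2 + 1))
  rw [← hsum]
  generalize hβ : ratios a (k + 1) = β at *
  have p0 : (0 : ℝ) < a k := by exact_mod_cast ha.pos _
  have p1 : (0 : ℝ) < a (k + 1) := by exact_mod_cast ha.pos _
  have p2 : (0 : ℝ) < a (k + 2) := by exact_mod_cast ha.pos _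
  have hrR : (β : ℝ) * a k = a (k + 1) := by exact_mod_cast hr
  have h21 : (2 : ℝ) * a (k + 1) ≤ a (k + 2) := by
    have : 2 * a (k + 1) ≤ a (k + 2) := by
      rw [← show _ = a (k + 2) from hr']
      exact Nat.mul_le_mul_right _ hb'
    exact_mod_cast this
  have hτ : 2 * (a (k + 1) * τ) ≤ 1 := by
    rw [le_div_iff₀ p2] at htail
    nlinarith
  have hcast : (((β - 1 : ℕ) : ℝ)) + 1 = β := by
    rw [Nat.cast_sub (by omega)]
    simp
  have hβs : (β : ℝ) * (a k * (c (k + 1) / a (k + 1) + τ)) = c (k + 1) + a (k + 1) * τ := by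
    rw [← mul_assoc, hrR]
    field_simp
  have hc1 : (1 : ℝ) ≤ c (k + 1) := by exact_mod_cast Nat.one_le_iff_ne_zero.2 h1
  have hc2 : (c (k + 1) : ℝ) + 1 ≤ β := by exact_mod_cast (show c (k + 1) + 1 ≤ β by omega)
  have hpos : 0 ≤ a (k + 1) * τ := by positivity
  refine le_four_mul_count_norm_nsmul (by omega) _ ?_ ?_
  · rw [hcast, mul_assoc, hβs]
    linarith
  · rw [hcast, mul_assoc, mul_sub, hβs]
    linarith

end Canonical

/-! ### Density along blocks -/

/-- A union of blocks `[u k, u (k+1))` whose density tends to `0` along the endpoints `u k` has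
density `0`. -/
theorem hasDensity_zero_of_blocks {u : ℕ → ℕ} (hu : StrictMono u) {L : Set ℕ}
    (hL : ∀ k, (∀ i, u k ≤ i → i < u (k + 1) → i ∈ L) ∨
      (∀ i, u k ≤ i → i < u (k + 1) → i ∉ L))
    (h : ∀ δ : ℝ, 0 < δ → ∀ᶠ k in atTop, ((L ∩ Set.Iio (u k)).ncard : ℝ) ≤ δ * u k) :
    HasDensity L 0 := by
  classical
  simp only [ncard_inter_Iio_eq_count] at h
  unfold HasDensity
  simp only [ncard_inter_Iio_eq_count]
  rw [Metric.tendsto_atTop]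
  intro ε hε
  obtain ⟨K, hK⟩ := eventually_atTop.1 (h (min (ε / 2) 1) (by positivity))
  refine ⟨u K + 1, fun n hn => ?_⟩
  obtain ⟨k, hk1, hk2⟩ : ∃ k, u k ≤ n ∧ n < u (k + 1) := by
    have hex : ∃ j, n < u j := ⟨n + 1, hu.le_apply⟩
    have hspec := Nat.find_spec hex
    have hne : Nat.find hex ≠ 0 := fun h0 => by
      rw [h0] at hspec
      have := hu.monotone (Nat.zero_le K)
      omega
    refine ⟨Nat.find hex - 1, ?_, ?_⟩
    · exact not_lt.1 (Nat.find_min hex (by omega))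
    · rwa [Nat.sub_add_cancel (by omega)]
  have hKk : K ≤ k := by
    by_contra! hlt
    have := hu.monotone (show k + 1 ≤ K from hlt)
    omega
  have hmain : (Nat.count (· ∈ L) n : ℝ) ≤ min (ε / 2) 1 * n := by
    rcases hL k with hin | hout
    · obtain ⟨d, hd⟩ := Nat.exists_eq_add_of_le hk2.le
      have hcount : Nat.count (· ∈ L) (u (k + 1)) = Nat.count (· ∈ L) n + d := by
        rw [hd, Nat.count_add, Nat.count_of_forall (n := d)
          fun i hi => hin (n + i) (by omega) (by omega)]
      have := hK (k + 1) (by omega)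
      rw [hcount, hd] at this
      push_cast at this
      have : min (ε / 2) 1 * d ≤ 1 * d := by
        gcongr
        exact min_le_right _ _
      linarith
    · obtain ⟨d, hd⟩ := Nat.exists_eq_add_of_le hk1
      have hcount : Nat.count (· ∈ L) n = Nat.count (· ∈ L) (u k) := by
        rw [hd, Nat.count_add, Nat.count_of_forall_not (n := d)
          fun i hi => hout (u k + i) (by omega) (by omega), add_zero]
      rw [hcount]
      refine (hK k hKk).trans ?_
      gcongr
  have hn0 : (0 : ℝ) < n := by exact_mod_cast (show 0 < n by omega)
  rw [Real.dist_eq, sub_zero, abs_of_nonneg (by positivity), div_lt_iff₀ hn0]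
  have : min (ε / 2) 1 * n ≤ ε / 2 * n := by
    gcongr
    exact min_le_left _ _
  nlinarith

theorem IsArithSeq.mem_liftSet_iff {a : ℕ → ℕ} (ha : IsArithSeq a) {A : Set ℕ} (hA : 0 ∉ A)
    {k i : ℕ} (h1 : nseq a k ≤ i) (h2 : i < nseq a (k + 1)) :
    i ∈ liftSet a A ↔ k + 1 ∈ A := by
  simp only [liftSet, Set.mem_iUnion, Set.mem_Icc, exists_prop]
  constructor
  · rintro ⟨j, hj, hj1, hj2⟩
    obtain _ | j := j
    · exact absurd hj hA
    rw [Nat.add_sub_cancel] at hj1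
    have := ha.one_le_nseq (j + 1)
    have e1 : j < k + 1 := ha.nseq_strictMono.lt_iff_lt.1 (by omega)
    have e2 : k < j + 1 := ha.nseq_strictMono.lt_iff_lt.1 (by omega)
    rwa [show k = j by omega]
  · exact fun h => ⟨k + 1, h, by simpa using h1, by omega⟩

/-- if `supp x` is infinite but not co-finite and
`d̄(L(supp x \ (supp x - 1))) > 0`, then `x ∉ t^s_{(d n)}(𝕋)`. -/
theorem not_mem_statChar_of_infinite_noncofinite_supp (a : ℕ → ℕ) (ha : IsArithSeq a)
    (c : ℕ → ℕ) (hc0 : c 0 = 0) (hcle : ∀ n, 1 ≤ n → c n ≤ ratios a n - 1)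
    (hcanon : {n : ℕ | 1 ≤ n ∧ c n < ratios a n - 1}.Infinite)
    (x : AddCircle (1 : ℝ))
    (hx : x = ((∑' n : ℕ, (c n : ℝ) / (a n : ℝ) : ℝ) : AddCircle (1 : ℝ)))
    (hinf : {n : ℕ | c n ≠ 0}.Infinite)
    (hncof : {n : ℕ | 1 ≤ n ∧ c n = 0}.Infinite)
    (hud : 0 < upperDensity
      (liftSet a ({n | c n ≠ 0} \ ((fun t => t - 1) '' {n | c n ≠ 0})))) :
    x ∉ statChar (fun n => (dSeq a n : ℤ)) := by
  classical
  intro hmem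
  set A : Set ℕ := {n | c n ≠ 0} \ ((fun t => t - 1) '' {n | c n ≠ 0}) with hAdef
  have hA0 : 0 ∉ A := fun h => h.1 hc0
  have hA (k : ℕ) (hk : k + 1 ∈ A) : c (k + 1) ≠ 0 ∧ c (k + 2) = 0 := by
    refine ⟨hk.1, ?_⟩
    by_contra h
    exact hk.2 ⟨k + 2, h, rfl⟩
  have hB : HasDensity {n : ℕ | (1 / 16 : ℝ) ≤ ‖(dSeq a n : ℤ) • x‖} 0 :=
    hmem (1 / 16) (by norm_num)
  set B : Set ℕ := {n : ℕ | (1 / 16 : ℝ) ≤ ‖(dSeq a n : ℤ) • x‖} with hBdef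
  have hcount (k : ℕ) : Nat.count (· ∈ liftSet a A) (nseq a k)
      ≤ 4 * Nat.count (· ∈ B) (nseq a k - 1) := by
    induction k with
    | zero =>
      have : 0 ∉ liftSet a A := by
        simp only [liftSet, Set.mem_iUnion, Set.mem_Icc, not_exists]
        intro j _ hj
        have := ha.one_le_nseq (j - 1)
        omega
      simp [nseq, Nat.count_succ, this]
    | succ k ih =>
      have h1 := ha.one_le_nseq k
      rw [nseq, Nat.count_add, Nat.sub_add_comm h1, Nat.count_add, mul_add]
      refine add_le_add ih ?_
      by_cases hk : k + 1 ∈ A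
      · refine le_trans (Nat.count_le _) ((ha.ratios_sub_one_le_count hcle (hA k hk).1
          (hA k hk).2).trans_eq ?_)
        rw [Nat.count_eq_card_filter_range, Nat.count_eq_card_filter_range]
        congr 2
        refine Finset.filter_congr fun i hi => ?_
        rw [Finset.mem_range] at hi
        rw [hBdef, Set.mem_ofPred_eq, ha.dSeq_eq k i hi, hx, natCast_zsmul, mul_nsmul']
      · rw [Nat.count_of_forall_not]
        · exact Nat.zero_le _
        · intro i hi
          rwa [ha.mem_liftSet_iff hA0 (k := k) (by omega) (by rw [nseq]; omega)]
  have hdens : HasDensity (liftSet a A) 0 := by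
    refine hasDensity_zero_of_blocks ha.nseq_strictMono (fun k => ?_) fun δ hδ => ?_
    · by_cases hk : k + 1 ∈ A
      · exact Or.inl fun i h1 h2 => (ha.mem_liftSet_iff hA0 h1 h2).2 hk
      · exact Or.inr fun i h1 h2 => (ha.mem_liftSet_iff hA0 h1 h2).not.2 hk
    · have hev := (hB.comp ha.nseq_strictMono.tendsto_atTop).eventually_le_const
        (show (0 : ℝ) < δ / 4 by positivity)
      filter_upwards [hev] with k hk
      have hpos : (0 : ℝ) < nseq a k := by exact_mod_cast ha.one_le_nseq k
      rw [Function.comp_apply, div_le_iff₀ hpos, ncard_inter_Iio_eq_count] at hk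
      rw [ncard_inter_Iio_eq_count]
      have h4 : (Nat.count (· ∈ liftSet a A) (nseq a k) : ℝ)
          ≤ 4 * Nat.count (· ∈ B) (nseq a k) := by
        exact_mod_cast (hcount k).trans
          (Nat.mul_le_mul_left 4 (Nat.count_monotone _ (Nat.sub_le _ _)))
      linarith
  exact hud.ne' hdens.limsup_eq
end
end

section
/- For any weakly dense density lifting invariant (weakly dense dli) arithmetic sequence (a_n), the statistically characterized subgroup t^s_{(d_n)}(T) cannot be characterized: there is no sequence of integers (u_n) such that t^s_{(d_n)}(T) = t_{(u_n)}(T). -/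
open Filter Topology Set

noncomputable section

/-- Weakly dense density lifting invariant. -/
def WeaklyDenseDli (a : ℕ → ℕ) : Prop :=
  ∀ K : Set ℕ, K.Infinite → ∃ A ⊆ K, A.Infinite ∧
    ∀ m : ℕ, HasDensity (liftSet a ((fun x => x - m) '' A)) 0

section Density

lemma ncard_inter_Iio_div_le_one (A : Set ℕ) (n : ℕ) :
    ((A ∩ Set.Iio n).ncard : ℝ) / n ≤ 1 := by
  refine div_le_one_of_le₀ ?_ (Nat.cast_nonneg n)
  have h := Set.ncard_le_ncard (Set.inter_subset_right (s := A)) (Set.finite_Iio n)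
  simp only [Set.ncard_Iio_nat] at h
  exact_mod_cast h

lemma HasDensity.mono_zero {A B : Set ℕ} (hAB : A ⊆ B) (hB : HasDensity B 0) :
    HasDensity A 0 := by
  refine squeeze_zero (fun n => by positivity) (fun n => ?_) hB
  have h := Set.ncard_le_ncard (Set.inter_subset_inter_left (Set.Iio n) hAB)
    ((Set.finite_Iio n).subset Set.inter_subset_right)
  gcongr

lemma HasDensity.union_zero {A B : Set ℕ} (hA : HasDensity A 0) (hB : HasDensity B 0) :
    HasDensity (A ∪ B) 0 := by
  have hAB := Tendsto.add hA hB
  rw [add_zero] at hAB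
  refine squeeze_zero (fun n => by positivity) (fun n => ?_) hAB
  rw [← add_div, Set.union_inter_distrib_right]
  have h := Set.ncard_union_le (A ∩ Set.Iio n) (B ∩ Set.Iio n)
  gcongr
  exact_mod_cast h

lemma HasDensity.of_finite {A : Set ℕ} (hA : A.Finite) : HasDensity A 0 := by
  refine squeeze_zero (fun n => by positivity) (fun n => ?_)
    (tendsto_const_div_atTop_nhds_zero_nat (A.ncard : ℝ))
  have h := Set.ncard_le_ncard (Set.inter_subset_left (t := Set.Iio n)) hA
  gcongr

lemma HasDensity.biUnion_lt_zero {A : ℕ → Set ℕ} (hA : ∀ j, HasDensity (A j) 0) (m : ℕ) :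
    HasDensity (⋃ j < m, A j) 0 := by
  induction m with
  | zero => exact HasDensity.of_finite (by simp)
  | succ m ih =>
    rw [Set.biUnion_lt_succ]
    exact ih.union_zero (hA m)

lemma HasDensity.preimage_succ_zero {A : Set ℕ} (hA : HasDensity A 0) :
    HasDensity {n | n + 1 ∈ A} 0 := by
  have hA' := Tendsto.add hA (tendsto_const_div_atTop_nhds_zero_nat (1 : ℝ))
  rw [add_zero] at hA'
  refine squeeze_zero (fun n => by positivity) (fun n => ?_) hA'
  rw [← add_div]
  have h : ({k | k + 1 ∈ A} ∩ Set.Iio n).ncard ≤ (insert n (A ∩ Set.Iio n)).ncard := by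
    refine Set.ncard_le_ncard_of_injOn (fun k => k + 1) ?_ (fun _ _ _ _ h => by simpa using h)
      (((Set.finite_Iio n).subset Set.inter_subset_right).insert n)
    rintro k ⟨hk, hkn⟩
    simp only [Set.mem_ofPred_eq, Set.mem_Iio, Set.mem_insert_iff, Set.mem_inter_iff] at hk hkn ⊢
    rcases Nat.lt_or_ge (k + 1) n with h | h
    · exact Or.inr ⟨hk, h⟩
    · left; omega
  have h' := h.trans (Set.ncard_insert_le _ _)
  gcongr
  exact_mod_cast h'

end Density

section Circle

lemma norm_two_nsmul_of_lt {x : AddCircle (1 : ℝ)} (hx : ‖x‖ < 1 / 4) : ‖2 • x‖ = 2 * ‖x‖ := by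
  induction x using QuotientAddGroup.induction_on with
  | H z =>
  have hz : ((z - round z : ℝ) : AddCircle (1 : ℝ)) = (z : AddCircle (1 : ℝ)) := by
    rw [AddCircle.coe_sub, sub_eq_self]
    exact (AddCircle.coe_eq_zero_iff 1).2 ⟨round z, by simp⟩
  change ‖(z : AddCircle (1 : ℝ))‖ < 1 / 4 at hx
  change ‖2 • (z : AddCircle (1 : ℝ))‖ = 2 * ‖(z : AddCircle (1 : ℝ))‖
  have hn : ‖(z : AddCircle (1 : ℝ))‖ = |z - round z| := by simp [AddCircle.norm_eq]
  rw [hn] at hx ⊢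
  rw [← hz, ← AddCircle.coe_nsmul, (AddCircle.norm_coe_eq_abs_iff 1 one_ne_zero).2] <;>
    simp only [nsmul_eq_mul, abs_mul] <;> norm_num
  linarith

lemma exists_nsmul_norm_ge {x : AddCircle (1 : ℝ)} (hx : x ≠ 0) :
    ∃ c : ℕ, 1 / 4 ≤ ‖c • x‖ := by
  by_contra! hc
  have h : ∀ j : ℕ, ‖2 ^ j • x‖ = 2 ^ j * ‖x‖ := by
    intro j
    induction j with
    | zero => simp
    | succ j ih => rw [pow_succ', mul_smul, norm_two_nsmul_of_lt (hc _), ih]; ring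
  obtain ⟨j, hj⟩ := pow_unbounded_of_one_lt (1 / ‖x‖) (one_lt_two (α := ℝ))
  have hpos := norm_pos_iff.2 hx
  rw [div_lt_iff₀ hpos, ← h j] at hj
  linarith [hc (2 ^ j)]

lemma norm_coe_le_abs_sub_int (y : ℝ) (z : ℤ) : ‖(y : AddCircle (1 : ℝ))‖ ≤ |y - z| := by
  rw [AddCircle.norm_eq]
  simpa using round_le y z

end Circle

section Expansion

variable {a : ℕ → ℕ}

lemma IsArithSeq.pos_s18 (ha : IsArithSeq a) (k : ℕ) : 0 < a k := by
  induction k with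
  | zero => simp [ha.1]
  | succ k ih => exact ih.trans (ha.2.1 k)

lemma IsArithSeq.strictMono_s18 (ha : IsArithSeq a) : StrictMono a :=
  strictMono_nat_of_lt_succ ha.2.1

lemma IsArithSeq.lt_apply (ha : IsArithSeq a) (k : ℕ) : k < a k := by
  induction k with
  | zero => exact ha.pos_s18 0
  | succ k ih => exact (Nat.succ_le_of_lt ih).trans_lt (ha.2.1 k)

lemma IsArithSeq.dvd_s18 (ha : IsArithSeq a) {i j : ℕ} (hij : i ≤ j) : a i ∣ a j := by
  induction j, hij using Nat.le_induction with
  | base => exact dvd_rfl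
  | succ j _ ih => exact ih.trans (ha.2.2 j)

lemma IsArithSeq.ratios_succ_mul (ha : IsArithSeq a) (k : ℕ) :
    ratios a (k + 1) * a k = a (k + 1) :=
  Nat.div_mul_cancel (ha.2.2 k)

lemma IsArithSeq.two_le_ratios_s18 (ha : IsArithSeq a) (k : ℕ) : 2 ≤ ratios a (k + 1) := by
  by_contra! h
  have h1 := ha.ratios_succ_mul k
  have h2 := ha.2.1 k
  have h3 : ratios a (k + 1) * a k ≤ 1 * a k := Nat.mul_le_mul_right _ (by omega)
  omega

lemma IsArithSeq.two_pow_mul_le (ha : IsArithSeq a) (k m : ℕ) : 2 ^ m * a k ≤ a (k + m) := by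
  induction m with
  | zero => simp
  | succ m ih =>
    calc 2 ^ (m + 1) * a k = 2 * (2 ^ m * a k) := by ring
      _ ≤ ratios a (k + m + 1) * a (k + m) := Nat.mul_le_mul (ha.two_le_ratios_s18 _) ih
      _ = a (k + (m + 1)) := ha.ratios_succ_mul _

/-- The partial sums of the expansion `∑ i, c i / a i`. -/
def expansionSum (a c : ℕ → ℕ) (k : ℕ) : ℝ := ∑ i ∈ Finset.range (k + 1), (c i : ℝ) / a i

lemma expansionSum_succ (a c : ℕ → ℕ) (k : ℕ) :
    expansionSum a c (k + 1) = expansionSum a c k + c (k + 1) / a (k + 1) :=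
  Finset.sum_range_succ _ _

lemma expansionSum_eq_of_forall_eq_zero {c : ℕ → ℕ} {k l : ℕ} (hkl : k ≤ l)
    (hc : ∀ i, k < i → i ≤ l → c i = 0) : expansionSum a c l = expansionSum a c k := by
  induction l, hkl using Nat.le_induction with
  | base => rfl
  | succ l hl ih =>
    rw [expansionSum_succ, ih fun i h1 h2 => hc i h1 (by omega), hc (l + 1) (by omega) le_rfl]
    simp

lemma IsArithSeq.exists_int_mul_expansionSum (ha : IsArithSeq a) (c : ℕ → ℕ) (k : ℕ) :
    ∃ z : ℤ, (a k : ℝ) * expansionSum a c k = z := by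
  refine ⟨∑ i ∈ Finset.range (k + 1), (c i : ℤ) * (a k / a i : ℕ), ?_⟩
  rw [expansionSum, Finset.mul_sum, Int.cast_sum]
  refine Finset.sum_congr rfl fun i hi => ?_
  have hi' : i ≤ k := by simpa [Nat.lt_succ_iff] using hi
  have h0 : (a i : ℝ) ≠ 0 := by exact_mod_cast (ha.pos_s18 i).ne'
  rw [Int.cast_mul, Int.cast_natCast, Int.cast_natCast, Nat.cast_div (ha.dvd_s18 hi') h0]
  ring

lemma IsArithSeq.exists_expansion (ha : IsArithSeq a) {c : ℕ → ℕ} (hc : ∀ i, c i < ratios a i) :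
    ∃ x : ℝ, ∀ k, expansionSum a c k ≤ x ∧ x ≤ expansionSum a c k + 1 / a k := by
  have hmono : Monotone (expansionSum a c) := monotone_nat_of_le_succ fun k => by
    rw [expansionSum_succ]
    exact le_add_of_nonneg_right (by positivity)
  have hanti : Antitone fun k => expansionSum a c k + 1 / a k := by
    refine antitone_nat_of_succ_le fun k => ?_
    have hk : (0 : ℝ) < a k := by exact_mod_cast ha.pos_s18 k
    have hb : ((c (k + 1) : ℝ) + 1) ≤ ratios a (k + 1) := by exact_mod_cast hc (k + 1)
    have hr : (a (k + 1) : ℝ) = ratios a (k + 1) * a k := by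
      exact_mod_cast (ha.ratios_succ_mul k).symm
    have hr0 : (0 : ℝ) < ratios a (k + 1) := by
      exact_mod_cast lt_of_lt_of_le two_pos (ha.two_le_ratios_s18 k)
    have hdiv : ((c (k + 1) : ℝ) + 1) / a (k + 1) ≤ 1 / a k := by
      rw [hr, div_le_div_iff₀ (by positivity) hk, one_mul]
      exact mul_le_mul_of_nonneg_right hb hk.le
    rw [expansionSum_succ, add_assoc, ← add_div]
    gcongr
  have h := Monotone.ciSup_mem_iInter_Icc_of_antitone hmono hanti
    (fun k => le_add_of_nonneg_right (by positivity))
  exact ⟨_, fun k => Set.mem_iInter.1 h k⟩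

end Expansion

section Enumeration

variable {a : ℕ → ℕ}

/-- The predicate enumerated by `dSeq a`. -/
def IsDTerm (a : ℕ → ℕ) (m : ℕ) : Prop :=
  ∃ k r : ℕ, 1 ≤ r ∧ r < ratios a (k + 1) ∧ m = r * a k

lemma dSeq_eq_nth (a : ℕ → ℕ) : dSeq a = Nat.nth (IsDTerm a) := rfl

lemma IsArithSeq.infinite_isDTerm (ha : IsArithSeq a) : (Set.ofPred (IsDTerm a)).Infinite := by
  refine Set.infinite_of_injective_forall_mem ha.strictMono_s18.injective fun k => ?_
  exact ⟨k, 1, le_rfl, ha.two_le_ratios_s18 k, (one_mul _).symm⟩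

lemma IsArithSeq.isDTerm_dSeq (ha : IsArithSeq a) (n : ℕ) : IsDTerm a (dSeq a n) :=
  Nat.nth_mem_of_infinite ha.infinite_isDTerm n

lemma IsArithSeq.dSeq_ne_zero (ha : IsArithSeq a) (n : ℕ) : dSeq a n ≠ 0 := by
  obtain ⟨k, r, hr, -, h⟩ := ha.isDTerm_dSeq n
  rw [h]
  exact (Nat.mul_pos hr (ha.pos_s18 k)).ne'

lemma IsArithSeq.dvd_of_isDTerm (ha : IsArithSeq a) {k m : ℕ} (hm : IsDTerm a m)
    (hkm : a k ≤ m) : a k ∣ m := by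
  obtain ⟨l, r, -, hr, rfl⟩ := hm
  have h : r * a l < a (l + 1) := by
    rw [← ha.ratios_succ_mul l]
    exact Nat.mul_lt_mul_of_pos_right hr (ha.pos_s18 l)
  have hkl : k < l + 1 := ha.strictMono_s18.lt_iff_lt.1 (hkm.trans_lt h)
  exact (ha.dvd_s18 (Nat.lt_succ_iff.1 hkl)).mul_left r

open Classical in
lemma IsArithSeq.count_mul_succ (ha : IsArithSeq a) {k r : ℕ} (hr : 1 ≤ r)
    (hr' : r < ratios a (k + 1)) :
    Nat.count (IsDTerm a) ((r + 1) * a k) = Nat.count (IsDTerm a) (r * a k) + 1 := by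
  obtain ⟨s, hs⟩ := Nat.exists_eq_succ_of_ne_zero (ha.pos_s18 k).ne'
  have h0 : Nat.count (fun i => IsDTerm a (r * a k + 1 + i)) s = 0 := by
    rw [Nat.count_iff_forall_not]
    intro i hi hd
    have h1 := ha.dvd_of_isDTerm hd (k := k) (by nlinarith)
    rw [add_assoc, Nat.dvd_add_right (dvd_mul_left _ _)] at h1
    have := Nat.le_of_dvd (by omega) h1
    omega
  have hsplit : (r + 1) * a k = r * a k + 1 + s := by rw [add_mul, one_mul]; omega
  rw [hsplit, Nat.count_add, h0, Nat.count_succ, if_pos ⟨k, r, hr, hr', rfl⟩]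

open Classical in
lemma IsArithSeq.count_mul_s18 (ha : IsArithSeq a) {k r : ℕ} (hr : 1 ≤ r)
    (hr' : r ≤ ratios a (k + 1)) :
    Nat.count (IsDTerm a) (r * a k) = Nat.count (IsDTerm a) (a k) + (r - 1) := by
  induction r, hr using Nat.le_induction with
  | base => simp
  | succ r hr ih =>
    rw [ha.count_mul_succ hr hr', ih (by omega)]
    omega

open Classical in
lemma IsArithSeq.count_succ_eq_nseq (ha : IsArithSeq a) (k : ℕ) :
    Nat.count (IsDTerm a) (a k) + 1 = nseq a k := by
  induction k with
  | zero =>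
    have h0 : ¬ IsDTerm a 0 := by
      rintro ⟨k, r, hr, -, h⟩
      exact (Nat.mul_pos hr (ha.pos_s18 k)).ne h
    rw [ha.1, Nat.count_succ, if_neg h0]
    rfl
  | succ k ih =>
    have h2 := ha.two_le_ratios_s18 k
    have h := ha.count_mul_s18 (k := k) (r := ratios a (k + 1)) (by omega) le_rfl
    rw [ha.ratios_succ_mul] at h
    rw [h, nseq, ← ih]
    omega

lemma IsArithSeq.succ_mem_Icc_nseq (ha : IsArithSeq a) {n k r : ℕ} (hr : 1 ≤ r)
    (hr' : r < ratios a (k + 1)) (hn : dSeq a n = r * a k) :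
    n + 1 ∈ Set.Icc (nseq a k) (nseq a (k + 1) - 1) := by
  classical
  have h := Nat.count_nth_of_infinite ha.infinite_isDTerm n
  rw [← dSeq_eq_nth, hn, ha.count_mul_s18 hr hr'.le] at h
  have hk := ha.count_succ_eq_nseq k
  have hk' : nseq a (k + 1) = nseq a k + (ratios a (k + 1) - 1) := rfl
  rw [hk', Set.mem_Icc]
  omega

end Enumeration

section StatChar

variable {a : ℕ → ℕ}

/-- If the gaps of `A` control the approximation of `x` by fractions with denominators `a k`,
and all translates of `A` lift to sets of density zero, then `x` is statistically characterized. -/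
lemma IsArithSeq.coe_mem_statChar (ha : IsArithSeq a) {A : Set ℕ}
    (hA : ∀ m : ℕ, HasDensity (liftSet a ((fun x => x - m) '' A)) 0) {x : ℝ}
    (hx : ∀ k m : ℕ, (∀ i ∈ A, k < i → k + m < i) →
      ∃ z : ℤ, |(a k : ℝ) * x - z| ≤ a k / a (k + m)) :
    (x : AddCircle (1 : ℝ)) ∈ statChar (fun n => (dSeq a n : ℤ)) := by
  intro ε hε
  obtain ⟨m, hm⟩ := exists_pow_lt_of_lt_one hε (one_half_lt_one (α := ℝ))
  refine HasDensity.mono_zero ?_ (HasDensity.biUnion_lt_zero hA (m + 1)).preimage_succ_zero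
  intro n hn
  obtain ⟨k, r, hr, hr', hd⟩ := ha.isDTerm_dSeq n
  by_contra hmem
  simp only [Set.mem_ofPred_eq, Set.mem_iUnion, not_exists] at hn hmem
  obtain ⟨z, hz⟩ := hx k (m + 1) fun i hi hki => by
    by_contra! hle
    refine hmem (i - (k + 1)) (by omega) (Set.mem_biUnion (x := k + 1) ⟨i, hi, ?_⟩ ?_)
    · dsimp only
      omega
    · exact ha.succ_mem_Icc_nseq hr hr' hd
  have hak : (0 : ℝ) < a k := by exact_mod_cast ha.pos_s18 k
  have hakm : (0 : ℝ) < a (k + (m + 1)) := by exact_mod_cast ha.pos_s18 _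
  have hra : (r : ℝ) * a k ≤ a (k + 1) := by
    rw [← ha.ratios_succ_mul k]
    exact_mod_cast Nat.mul_le_mul_right _ hr'.le
  have hpow : (2 : ℝ) ^ m * a (k + 1) ≤ a (k + (m + 1)) := by
    have := ha.two_pow_mul_le (k + 1) m
    rw [show k + 1 + m = k + (m + 1) by ring] at this
    exact_mod_cast this
  have hle : ‖((dSeq a n : ℤ)) • (x : AddCircle (1 : ℝ))‖ ≤ (1 / 2) ^ m := by
    rw [← AddCircle.coe_zsmul]
    refine (norm_coe_le_abs_sub_int _ (r * z)).trans ?_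
    have heq : (dSeq a n : ℤ) • x - ((r * z : ℤ) : ℝ) = r * (a k * x - z) := by
      rw [hd]
      push_cast
      simp only [zsmul_eq_mul]
      push_cast
      ring
    rw [heq, abs_mul, Nat.abs_cast]
    calc (r : ℝ) * |a k * x - z| ≤ r * (a k / a (k + (m + 1))) := by gcongr
      _ = r * a k / a (k + (m + 1)) := by ring
      _ ≤ (1 / 2) ^ m := by
        rw [div_le_iff₀ hakm, one_div, inv_pow, inv_mul_eq_div, le_div_iff₀ (by positivity)]
        nlinarith [pow_pos (two_pos (α := ℝ)) m]
  linarith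

lemma IsArithSeq.coe_inv_mem_statChar (ha : IsArithSeq a) (K : ℕ) :
    (((1 / a K : ℝ)) : AddCircle (1 : ℝ)) ∈ statChar (fun n => (dSeq a n : ℤ)) := by
  refine ha.coe_mem_statChar (A := {K}) (fun m => HasDensity.of_finite ?_) fun k m h => ?_
  · simp only [liftSet, Set.image_singleton, Set.biUnion_singleton]
    exact Set.finite_Icc _ _
  · have hK : (0 : ℝ) < a K := by exact_mod_cast ha.pos_s18 K
    rcases Nat.lt_or_ge k K with hk | hk
    · have hm := ha.strictMono_s18.monotone (h K rfl hk).le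
      have hkm : (0 : ℝ) < a (k + m) := by exact_mod_cast ha.pos_s18 _
      refine ⟨0, ?_⟩
      rw [Int.cast_zero, sub_zero, mul_one_div, abs_of_nonneg (by positivity)]
      gcongr
    · refine ⟨(a k / a K : ℕ), ?_⟩
      rw [Int.cast_natCast, Nat.cast_div (ha.dvd_s18 hk) hK.ne', mul_one_div, sub_self, abs_zero]
      positivity

lemma IsArithSeq.expansion_mem_statChar (ha : IsArithSeq a) {A : Set ℕ}
    (hA : ∀ m : ℕ, HasDensity (liftSet a ((fun x => x - m) '' A)) 0) {c : ℕ → ℕ}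
    (hcA : ∀ i, i ∉ A → c i = 0) {x : ℝ}
    (hx : ∀ k, expansionSum a c k ≤ x ∧ x ≤ expansionSum a c k + 1 / a k) :
    (x : AddCircle (1 : ℝ)) ∈ statChar (fun n => (dSeq a n : ℤ)) := by
  refine ha.coe_mem_statChar hA fun k m h => ?_
  obtain ⟨z, hz⟩ := ha.exists_int_mul_expansionSum c k
  refine ⟨z, ?_⟩
  have hs : expansionSum a c (k + m) = expansionSum a c k :=
    expansionSum_eq_of_forall_eq_zero (Nat.le_add_right k m) fun i h1 h2 => hcA i fun hi =>
      absurd (h i hi h1) (by omega)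
  obtain ⟨h1, h2⟩ := hx (k + m)
  rw [hs] at h1 h2
  rw [← hz, ← mul_sub, abs_mul, Nat.abs_cast, abs_of_nonneg (by linarith), div_eq_mul_one_div]
  gcongr
  linarith

end StatChar

section Proper

open MeasureTheory

lemma ncard_inter_Iio_eq_sum_indicator {X : Type*} (E : Set X) (f : ℕ → X) (N : ℕ) :
    (({n | f n ∈ E} ∩ Set.Iio N).ncard : ℝ) =
      ∑ n ∈ Finset.range N, E.indicator (fun _ => (1 : ℝ)) (f n) := by
  classical
  have h : {n | f n ∈ E} ∩ Set.Iio N = ((Finset.range N).filter fun n => f n ∈ E : Finset ℕ) := by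
    ext n
    simp [and_comm]
  rw [h, Set.ncard_coe_finset, Finset.card_filter]
  push_cast
  exact Finset.sum_congr rfl fun n _ => by simp [Set.indicator_apply]

lemma exists_notMem_statChar {d : ℕ → ℤ} (hd : ∀ n, d n ≠ 0) : ∃ x, x ∉ statChar d := by
  by_contra! hall
  set E : Set (AddCircle (1 : ℝ)) := {x | 1 / 4 ≤ ‖x‖} with hE
  have hEm : MeasurableSet E := measurableSet_le measurable_const measurable_norm
  set f : ℕ → AddCircle (1 : ℝ) → ℝ := fun N x =>
    (∑ n ∈ Finset.range N, E.indicator (fun _ => (1 : ℝ)) (d n • x)) / N with hf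
  have hf' : ∀ N x, f N x = (({n | d n • x ∈ E} ∩ Set.Iio N).ncard : ℝ) / N := fun N x => by
    rw [ncard_inter_Iio_eq_sum_indicator E (fun n => d n • x)]
  have hmp : ∀ n, MeasurePreserving (fun x : AddCircle (1 : ℝ) => d n • x) volume volume :=
    fun n => Measure.measurePreserving_zsmul volume (hd n)
  have hind : Measurable (E.indicator fun _ => (1 : ℝ)) := measurable_const.indicator hEm
  have hlim : Tendsto (fun N => ∫ x, f N x) atTop (𝓝 (∫ _x : AddCircle (1 : ℝ), (0 : ℝ))) := by
    refine tendsto_integral_of_dominated_convergence (fun _ => 1) (fun N => ?_)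
      (integrable_const _) (fun N => ?_) ?_
    · refine Measurable.aestronglyMeasurable (Measurable.div_const ?_ _)
      exact Finset.measurable_sum _ fun n _ => hind.comp (hmp n).measurable
    · refine Eventually.of_forall fun x => ?_
      rw [hf', Real.norm_of_nonneg (by positivity)]
      exact ncard_inter_Iio_div_le_one _ _
    · refine Eventually.of_forall fun x => ?_
      simp only [hf']
      exact hall x (1 / 4) (by norm_num)
  have hpre : ∀ n, (fun x : AddCircle (1 : ℝ) => E.indicator (fun _ => (1 : ℝ)) (d n • x)) =
      ((fun x => d n • x) ⁻¹' E).indicator 1 := fun n => by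
    ext x
    by_cases hx : d n • x ∈ E
    · rw [Set.indicator_of_mem hx, Set.indicator_of_mem (Set.mem_preimage.2 hx), Pi.one_apply]
    · rw [Set.indicator_of_notMem hx, Set.indicator_of_notMem (mt Set.mem_preimage.1 hx)]
  have hpm : ∀ n, MeasurableSet ((fun x : AddCircle (1 : ℝ) => d n • x) ⁻¹' E) :=
    fun n => (hmp n).measurable hEm
  have hint : ∀ n, Integrable (fun x : AddCircle (1 : ℝ) =>
      E.indicator (fun _ => (1 : ℝ)) (d n • x)) := fun n => by
    rw [hpre]
    exact (integrable_const (1 : ℝ)).indicator (hpm n)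
  have hval : ∀ n, ∫ x : AddCircle (1 : ℝ), E.indicator (fun _ => (1 : ℝ)) (d n • x) =
      volume.real E := fun n => by
    rw [hpre, integral_indicator_one (hpm n)]
    exact (hmp n).measureReal_preimage hEm.nullMeasurableSet
  have hconst : ∀ᶠ N : ℕ in atTop, ∫ x, f N x = volume.real E := by
    filter_upwards [eventually_gt_atTop 0] with N hN
    have hN' : (N : ℝ) ≠ 0 := by exact_mod_cast hN.ne'
    rw [hf, integral_div, integral_finsetSum _ fun n _ => hint n]
    simp only [hval, Finset.sum_const, Finset.card_range, nsmul_eq_mul]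
    field_simp
  have hzero : volume.real E = 0 := by
    have h := tendsto_nhds_unique (tendsto_const_nhds.congr' (hconst.mono fun _ h => h.symm)) hlim
    simpa using h
  have hcompl : Eᶜ ⊆ Metric.closedBall 0 (1 / 4) := fun x hx => by
    simp only [hE, Set.mem_compl_iff, Set.mem_ofPred_eq, not_le] at hx
    simpa using hx.le
  have hball : volume (Metric.closedBall (0 : AddCircle (1 : ℝ)) (1 / 4)) =
      ENNReal.ofReal (1 / 2) := by
    rw [AddCircle.volume_closedBall]
    norm_num
  have h1 : volume.real Eᶜ ≤ 1 / 2 := by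
    refine ENNReal.toReal_le_of_le_ofReal (by norm_num) ?_
    rw [← hball]
    exact measure_mono hcompl
  have h2 := measureReal_add_measureReal_compl (μ := volume) hEm
  rw [hzero, zero_add, measureReal_def _ Set.univ, AddCircle.measure_univ, ENNReal.ofReal_one,
    ENNReal.toReal_one] at h2
  linarith

end Proper

section Characterizing

variable {a : ℕ → ℕ} {u : ℕ → ℤ}

lemma IsArithSeq.eventually_dvd (ha : IsArithSeq a) {K : ℕ}
    (h : (((1 / a K : ℝ)) : AddCircle (1 : ℝ)) ∈ charSub u) :
    ∀ᶠ n in atTop, (a K : ℤ) ∣ u n := by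
  have hK : (0 : ℝ) < a K := by exact_mod_cast ha.pos_s18 K
  have hlim : Tendsto (fun n => ‖u n • (((1 / a K : ℝ)) : AddCircle (1 : ℝ))‖) atTop (𝓝 0) := by
    simpa using Tendsto.norm h
  filter_upwards [hlim.eventually_lt_const (one_div_pos.2 hK)] with n hn
  rw [← AddCircle.coe_zsmul, AddCircle.norm_eq] at hn
  set z := round ((1 : ℝ)⁻¹ * (u n • (1 / a K : ℝ)))
  have heq : u n • (1 / a K : ℝ) - z * 1 = ((u n - z * a K : ℤ) : ℝ) / a K := by
    rw [zsmul_eq_mul]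
    push_cast
    field_simp
  rw [heq, abs_div, Nat.abs_cast, div_lt_div_iff_of_pos_right hK] at hn
  have hlt : |u n - z * a K| < 1 := by exact_mod_cast hn
  exact ⟨z, by linarith [Int.abs_lt_one_iff.1 hlt]⟩

/-- The indices at which divisibility of some `u n` by the terms of `a` breaks off. -/
lemma IsArithSeq.infinite_break (ha : IsArithSeq a)
    (hdvd : ∀ K, ∀ᶠ n in atTop, (a K : ℤ) ∣ u n) (hu : ∃ᶠ n in atTop, u n ≠ 0) :
    {k | ∃ n, (a (k - 1) : ℤ) ∣ u n ∧ ¬ (a k : ℤ) ∣ u n}.Infinite := by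
  classical
  refine Set.infinite_of_not_bddAbove ?_
  rintro ⟨M, hM⟩
  obtain ⟨n, hn0, hn⟩ := (hu.and_eventually (hdvd M)).exists
  have hex : ∃ k, ¬ (a k : ℤ) ∣ u n := by
    refine ⟨(u n).natAbs, fun hd => ?_⟩
    have h1 := Nat.le_of_dvd (Int.natAbs_pos.2 hn0) (Int.natCast_dvd.1 hd)
    exact absurd (ha.lt_apply (u n).natAbs) (not_lt.2 h1)
  have hfind := Nat.find_spec hex
  have hMk : M < Nat.find hex := by
    by_contra! hle
    exact hfind ((Int.natCast_dvd_natCast.2 (ha.dvd_s18 hle)).trans hn)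
  have hpred := Nat.find_min hex (m := Nat.find hex - 1) (by omega)
  exact absurd (hM ⟨n, not_not.1 hpred, hfind⟩) (by omega)

lemma IsArithSeq.exists_digit (ha : IsArithSeq a) {k : ℕ} {v : ℤ} (h1 : (a (k - 1) : ℤ) ∣ v)
    (h2 : ¬ (a k : ℤ) ∣ v) :
    ∃ c < ratios a k, 1 / 4 ≤ ‖((v * (c / a k) : ℝ) : AddCircle (1 : ℝ))‖ := by
  obtain _ | k := k
  · exact absurd h1 h2
  have hk : (a (k + 1) : ℝ) ≠ 0 := by exact_mod_cast (ha.pos_s18 _).ne'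
  set y : AddCircle (1 : ℝ) := ((v / a (k + 1) : ℝ) : AddCircle (1 : ℝ)) with hy
  have hy0 : y ≠ 0 := by
    rw [hy, Ne, AddCircle.coe_eq_zero_iff]
    rintro ⟨z, hz⟩
    refine h2 ⟨z, ?_⟩
    rw [zsmul_eq_mul, mul_one, eq_div_iff hk] at hz
    rw [mul_comm]
    exact_mod_cast hz.symm
  have hby : ratios a (k + 1) • y = 0 := by
    obtain ⟨w, hw⟩ := h1
    rw [hy, ← AddCircle.coe_nsmul, AddCircle.coe_eq_zero_iff]
    refine ⟨w, ?_⟩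
    rw [Nat.add_sub_cancel] at hw
    have hr : (a (k + 1) : ℝ) = ratios a (k + 1) * a k := by
      exact_mod_cast (ha.ratios_succ_mul k).symm
    rw [zsmul_eq_mul, mul_one, nsmul_eq_mul, ← mul_div_assoc, eq_div_iff hk, hr, hw]
    push_cast
    ring
  obtain ⟨c, hc⟩ := exists_nsmul_norm_ge hy0
  refine ⟨c % ratios a (k + 1), Nat.mod_lt _ (by linarith [ha.two_le_ratios_s18 k]), ?_⟩
  have hmod : (c % ratios a (k + 1)) • y = c • y := by
    conv_rhs => rw [← Nat.mod_add_div c (ratios a (k + 1)), add_smul, mul_comm, mul_smul, hby,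
      smul_zero, add_zero]
  rw [← hmod, hy, ← AddCircle.coe_nsmul, nsmul_eq_mul] at hc
  convert hc using 3
  ring

lemma exists_sparse_sequence {A : Set ℕ} (hA : A.Infinite) (f : ℕ → ℕ) :
    ∃ g : ℕ → ℕ, StrictMono g ∧ (∀ j, g j ∈ A) ∧ ∀ j, f (g j) < g (j + 1) := by
  choose φ hφA hφ using fun N => hA.exists_gt N
  have hrec : ∀ j, (fun s => φ (f s + s))^[j + 1] (φ 0) =
      φ (f ((fun s => φ (f s + s))^[j] (φ 0)) + (fun s => φ (f s + s))^[j] (φ 0)) := fun j =>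
    Function.iterate_succ_apply' _ _ _
  refine ⟨fun j => (fun s => φ (f s + s))^[j] (φ 0), strictMono_nat_of_lt_succ fun j => ?_,
    fun j => ?_, fun j => ?_⟩
  · rw [hrec]
    exact lt_of_le_of_lt (Nat.le_add_left _ _) (hφ _)
  · cases j with
    | zero => exact hφA 0
    | succ j =>
      dsimp only
      rw [hrec]
      exact hφA _
  · dsimp only
    rw [hrec]
    exact lt_of_le_of_lt (Nat.le_add_right _ _) (hφ _)

/-- A sparse expansion supported on the breaking indices keeps `u n • x` away from zero. -/
lemma IsArithSeq.norm_expansion_ge (ha : IsArithSeq a) {c : ℕ → ℕ} {x : ℝ}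
    (hx : ∀ k, expansionSum a c k ≤ x ∧ x ≤ expansionSum a c k + 1 / a k) {s t : ℕ} {v : ℤ}
    (hst : s < t) (hc : ∀ i, s < i → i < t → c i = 0) (hdvd : (a (s - 1) : ℤ) ∣ v) (hs : s ≠ 0)
    (hv : 8 * v.natAbs < t)
    (hcs : 1 / 4 ≤ ‖((v * (c s / a s) : ℝ) : AddCircle (1 : ℝ))‖) :
    1 / 8 ≤ ‖v • (x : AddCircle (1 : ℝ))‖ := by
  obtain ⟨s, rfl⟩ := Nat.exists_eq_succ_of_ne_zero hs
  obtain ⟨t, rfl⟩ := Nat.exists_eq_succ_of_ne_zero (Nat.ne_zero_of_lt hst)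
  have hsum : expansionSum a c t = expansionSum a c s + c (s + 1) / a (s + 1) := by
    rw [← expansionSum_succ]
    exact expansionSum_eq_of_forall_eq_zero (by omega) fun i h1 h2 => hc i h1 (by omega)
  obtain ⟨w, hw⟩ := hdvd
  rw [Nat.succ_sub_one] at hw
  obtain ⟨z, hz⟩ := ha.exists_int_mul_expansionSum c s
  obtain ⟨h1, h2⟩ := hx t
  have hat : (0 : ℝ) < a t := by exact_mod_cast ha.pos_s18 t
  have herr : |(v : ℝ) * (x - expansionSum a c t)| ≤ 1 / 8 := by
    have hta : t ≤ a t := ha.strictMono_s18.le_apply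
    have hvt : 8 * |(v : ℝ)| ≤ a t := by
      have : 8 * v.natAbs ≤ a t := by omega
      rw [← Int.cast_abs, Int.abs_eq_natAbs]
      exact_mod_cast this
    rw [abs_mul, abs_of_nonneg (sub_nonneg.2 h1)]
    calc |(v : ℝ)| * (x - expansionSum a c t) ≤ |(v : ℝ)| * (1 / a t) := by
          gcongr
          linarith
      _ ≤ 1 / 8 := by
        rw [mul_one_div, div_le_iff₀ hat]
        linarith
  have hdecomp : v • (x : AddCircle (1 : ℝ)) =
      ((v * (c (s + 1) / a (s + 1)) : ℝ) : AddCircle (1 : ℝ)) +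
        ((v * (x - expansionSum a c t) : ℝ) : AddCircle (1 : ℝ)) := by
    rw [← AddCircle.coe_zsmul, ← AddCircle.coe_add, ← sub_eq_zero, ← AddCircle.coe_sub,
      AddCircle.coe_eq_zero_iff]
    refine ⟨w * z, ?_⟩
    rw [hsum, zsmul_eq_mul, zsmul_eq_mul, hw]
    push_cast
    rw [← hz]
    ring
  have herr' : ‖((v * (x - expansionSum a c t) : ℝ) : AddCircle (1 : ℝ))‖ ≤ 1 / 8 := by
    refine (norm_coe_le_abs_sub_int _ 0).trans ?_
    simpa using herr
  have htri := norm_sub_le_norm_add ((v * (c (s + 1) / a (s + 1)) : ℝ) : AddCircle (1 : ℝ))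
    ((v * (x - expansionSum a c t) : ℝ) : AddCircle (1 : ℝ))
  rw [hdecomp]
  simp only [Nat.succ_eq_add_one] at hcs
  linarith

lemma IsArithSeq.eventually_eq_zero_of_statChar_subset (ha : IsArithSeq a) (h : WeaklyDenseDli a)
    (hu : statChar (fun n => (dSeq a n : ℤ)) ⊆ charSub u) : ∀ᶠ n in atTop, u n = 0 := by
  classical
  by_contra hne
  have hdvd : ∀ K, ∀ᶠ n in atTop, (a K : ℤ) ∣ u n := fun K =>
    ha.eventually_dvd (hu (ha.coe_inv_mem_statChar K))
  obtain ⟨A, hAK, hAinf, hA⟩ := h _ (ha.infinite_break hdvd (not_eventually.1 hne))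
  have hex : ∀ k, ∃ n c, k ∈ A → ((a (k - 1) : ℤ) ∣ u n ∧ ¬ (a k : ℤ) ∣ u n) ∧
      c < ratios a k ∧ 1 / 4 ≤ ‖((u n * (c / a k) : ℝ) : AddCircle (1 : ℝ))‖ := by
    intro k
    by_cases hk : k ∈ A
    · obtain ⟨n, h1, h2⟩ := hAK hk
      obtain ⟨c, hc, hc'⟩ := ha.exists_digit h1 h2
      exact ⟨n, c, fun _ => ⟨⟨h1, h2⟩, hc, hc'⟩⟩
    · exact ⟨0, 0, fun hk' => absurd hk' hk⟩
  choose n c₀ hspec using hex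
  obtain ⟨g, hg, hgA, hgf⟩ := exists_sparse_sequence hAinf fun k => 8 * (u (n k)).natAbs
  have hratios : ∀ i, 0 < ratios a i := by
    rintro (_ | i)
    · simp [ratios, ha.1]
    · exact lt_of_lt_of_le two_pos (ha.two_le_ratios_s18 i)
  set c : ℕ → ℕ := fun i => if i ∈ Set.range g then c₀ i else 0 with hcdef
  have hc : ∀ i, c i < ratios a i := by
    intro i
    by_cases hi : i ∈ Set.range g
    · simp only [hcdef, if_pos hi]
      obtain ⟨j, rfl⟩ := hi
      exact (hspec _ (hgA j)).2.1
    · simpa only [hcdef, if_neg hi] using hratios i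
  obtain ⟨x, hx⟩ := ha.exists_expansion hc
  have hxs := hu (ha.expansion_mem_statChar hA (c := c) (fun i hi => if_neg (by
    rintro ⟨j, rfl⟩
    exact hi (hgA j))) hx)
  have hlim : Tendsto (fun n => ‖u n • (x : AddCircle (1 : ℝ))‖) atTop (𝓝 0) := by
    simpa using Tendsto.norm hxs
  have hinj : Function.Injective fun j => n (g j) := by
    refine Function.Injective.of_lt_imp_ne fun i j hij heq => ?_
    have h1 := (hspec _ (hgA i)).1.2
    have h2 := (hspec _ (hgA j)).1.1
    rw [show n (g i) = n (g j) from heq] at h1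
    have h3 := hg hij
    exact h1 ((Int.natCast_dvd_natCast.2 (ha.dvd_s18 (by omega))).trans h2)
  have hev := (hlim.comp hinj.nat_tendsto_atTop).eventually_lt_const
    (show (0 : ℝ) < 1 / 8 by norm_num)
  obtain ⟨j, hj⟩ := hev.exists
  obtain ⟨⟨h1, h2⟩, -, h4⟩ := hspec _ (hgA j)
  refine absurd hj (not_lt.2 (ha.norm_expansion_ge hx (hg (Nat.lt_succ_self j)) ?_ h1 ?_ (hgf j) ?_))
  · rintro i hi1 hi2
    refine if_neg ?_
    rintro ⟨l, rfl⟩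
    have := hg.lt_iff_lt.1 hi1
    have := hg.lt_iff_lt.1 hi2
    omega
  · intro h0
    rw [h0] at h1 h2
    exact h2 h1
  · simpa only [hcdef, if_pos (Set.mem_range_self j)] using h4

end Characterizing

/-- for a weakly dense dli arithmetic sequence, `t^s_{(d n)}(𝕋)` cannot be
characterized by any sequence of integers. -/
theorem statChar_not_characterizable (a : ℕ → ℕ) (ha : IsArithSeq a)
    (h : WeaklyDenseDli a) :
    ¬ ∃ u : ℕ → ℤ, statChar (fun n => (dSeq a n : ℤ)) = charSub u := by
  rintro ⟨u, hu⟩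
  have hzero := ha.eventually_eq_zero_of_statChar_subset h hu.subset
  obtain ⟨x, hx⟩ := exists_notMem_statChar (d := fun n => (dSeq a n : ℤ))
    fun n => Int.natCast_ne_zero.2 (ha.dSeq_ne_zero n)
  refine hx (hu ▸ ?_)
  refine tendsto_const_nhds.congr' ?_
  filter_upwards [hzero] with n hn
  rw [hn, zero_smul]
end
end
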